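/- Let X₁, X₂, X̂₁, X̂₂ ∈ ℝ^{n×d}. Let W be a minimizer of O ↦ ‖X₁O − X₂‖_F over O(d), Ŵ a minimizer of O ↦ ‖X̂₁O − X̂₂‖_F, W₁ a minimizer of O ↦ ‖X̂₁O − X₁‖_F, and W₂ a minimizer of O ↦ ‖X̂₂O − X₂‖_F. Then | ‖X̂₁Ŵ − X̂₂‖_F − ‖X₁W − X₂‖_F | ≤ ‖X̂₁W₁ − X₁‖_F + ‖X̂₂W₂ − X₂‖_F + ‖X₁‖_F · ‖W − W₁ᵀ Ŵ W₂‖, where the last norm is the spectral norm. -/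

import Mathlib

open Matrix MeasureTheory ProbabilityTheory Filter

/-- Frobenius norm of a real matrix. -/
noncomputable def frob {m n : ℕ} (A : Matrix (Fin m) (Fin n) ℝ) : ℝ :=
  Real.sqrt (∑ i, ∑ j, (A i j) ^ 2)

/-- Euclidean norm of a vector. -/
noncomputable def vnorm {n : ℕ} (x : Fin n → ℝ) : ℝ :=
  Real.sqrt (∑ i, (x i) ^ 2)

/-- Spectral norm (operator 2-norm) of a real matrix. -/
noncomputable def spec {m n : ℕ} (A : Matrix (Fin m) (Fin n) ℝ) : ℝ :=
  sSup {r : ℝ | ∃ x : Fin n → ℝ, vnorm x ≤ 1 ∧ r = vnorm (A.mulVec x)}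

/-- Smallest singular value of a square real matrix. -/
noncomputable def sigmaMin {n : ℕ} (A : Matrix (Fin n) (Fin n) ℝ) : ℝ :=
  sInf {r : ℝ | ∃ x : Fin n → ℝ, vnorm x = 1 ∧ r = vnorm (A.mulVec x)}

/-- Procrustes distance `min_{O ∈ O(d)} ‖X O − Y‖_F`. -/
noncomputable def procDist {n d : ℕ} (X Y : Matrix (Fin n) (Fin d) ℝ) : ℝ :=
  sInf {r : ℝ | ∃ O ∈ Matrix.orthogonalGroup (Fin d) ℝ, r = frob (X * O - Y)}

/-- Distance matrix `D_{t₁,t₂} = n^{-1/2} min_{O∈O(d)} ‖X_{t₁} O − X_{t₂}‖_F`. -/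
noncomputable def distMat {n d T : ℕ} (X : Fin T → Matrix (Fin n) (Fin d) ℝ) :
    Matrix (Fin T) (Fin T) ℝ :=
  Matrix.of fun t₁ t₂ => (Real.sqrt n)⁻¹ * procDist (X t₁) (X t₂)

/-- The centering matrix `J = I − (1/T) 𝟙𝟙ᵀ`. -/
noncomputable def centerJ (T : ℕ) : Matrix (Fin T) (Fin T) ℝ :=
  1 - ((T : ℝ))⁻¹ • Matrix.of (fun _ _ => (1 : ℝ))

/-- The doubly centered matrix `B = −(1/2) J D∘2 J`. -/
noncomputable def dcB {T : ℕ} (D : Matrix (Fin T) (Fin T) ℝ) : Matrix (Fin T) (Fin T) ℝ :=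
  (-(1/2 : ℝ)) • (centerJ T * Matrix.of (fun i j => (D i j) ^ 2) * centerJ T)

/-- Maximum absolute entry of a matrix. -/
noncomputable def normMax {m n : ℕ} (A : Matrix (Fin m) (Fin n) ℝ) : ℝ := ⨆ i, ⨆ j, |A i j|

/-- `lam` lists the eigenvalues of the real symmetric matrix `B` in nonincreasing order:
it is nonincreasing and `B = V (diag lam) Vᵀ` for some orthogonal `V`. -/
def SortedDecomp {T : ℕ} (B : Matrix (Fin T) (Fin T) ℝ) (lam : Fin T → ℝ) : Prop :=
  (∀ i j : Fin T, i ≤ j → lam j ≤ lam i) ∧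
  ∃ V ∈ Matrix.orthogonalGroup (Fin T) ℝ, B = V * Matrix.diagonal lam * Vᵀ

/-- `Xh` is an adjacency spectral embedding of dimension `d` of the symmetric matrix `A`:
`Xh = Û |Λ̂|^{1/2}` where `Λ̂` contains the `d` largest eigenvalues of `A` and the columns
of `Û` are corresponding orthonormal eigenvectors. -/
def IsASE {n d : ℕ} (hdn : d ≤ n) (A : Matrix (Fin n) (Fin n) ℝ)
    (Xh : Matrix (Fin n) (Fin d) ℝ) : Prop :=
  ∃ (V : Matrix (Fin n) (Fin n) ℝ) (lam : Fin n → ℝ),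
    V ∈ Matrix.orthogonalGroup (Fin n) ℝ ∧
    (∀ i j : Fin n, i ≤ j → lam j ≤ lam i) ∧
    A = V * Matrix.diagonal lam * Vᵀ ∧
    Xh = V.submatrix id (Fin.castLE hdn) *
      Matrix.diagonal (fun k : Fin d => Real.sqrt |lam (Fin.castLE hdn k)|)

/-- `W` is a minimizer of `O ↦ ‖X O − Y‖_F` over the orthogonal group `O(d)`. -/
def IsProcMin {n d : ℕ} (X Y : Matrix (Fin n) (Fin d) ℝ)
    (W : Matrix (Fin d) (Fin d) ℝ) : Prop :=
  W ∈ Matrix.orthogonalGroup (Fin d) ℝ ∧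
    ∀ O ∈ Matrix.orthogonalGroup (Fin d) ℝ, frob (X * W - Y) ≤ frob (X * O - Y)

section Helpers
attribute [local instance] Matrix.frobeniusNormedAddCommGroup

lemma frob_eq_norm {m n : ℕ} (A : Matrix (Fin m) (Fin n) ℝ) : frob A = ‖A‖ := by
  rw [Matrix.frobenius_norm_def, frob, Real.sqrt_eq_rpow]
  simp

lemma frob_add_le {m n : ℕ} (A B : Matrix (Fin m) (Fin n) ℝ) :
    frob (A + B) ≤ frob A + frob B := by
  simp only [frob_eq_norm]
  exact norm_add_le A B

lemma frob_neg {m n : ℕ} (A : Matrix (Fin m) (Fin n) ℝ) : frob (-A) = frob A := by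
  simp [frob]

end Helpers

lemma frob_eq_trace {m n : ℕ} (A : Matrix (Fin m) (Fin n) ℝ) :
    frob A = Real.sqrt (Matrix.trace (A * Aᵀ)) := by
  simp [frob, Matrix.trace, Matrix.mul_apply, pow_two]

lemma frob_mul_orth {m n : ℕ} (A : Matrix (Fin m) (Fin n) ℝ) (O : Matrix (Fin n) (Fin n) ℝ)
    (hO : O * Oᵀ = 1) : frob (A * O) = frob A := by
  rw [frob_eq_trace, frob_eq_trace, Matrix.transpose_mul, Matrix.mul_assoc,
    ← Matrix.mul_assoc O, hO, Matrix.one_mul]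

lemma spec_nonneg {m n : ℕ} (A : Matrix (Fin m) (Fin n) ℝ) : 0 ≤ spec A := by
  apply Real.sSup_nonneg
  rintro r ⟨x, -, rfl⟩
  exact Real.sqrt_nonneg _

lemma orth_transpose {d : ℕ} {O : Matrix (Fin d) (Fin d) ℝ}
    (h : O ∈ Matrix.orthogonalGroup (Fin d) ℝ) : Oᵀ ∈ Matrix.orthogonalGroup (Fin d) ℝ := by
  rw [Matrix.mem_orthogonalGroup_iff]
  have := (Matrix.mem_orthogonalGroup_iff' (Fin d) ℝ).1 h
  simpa [Matrix.star_eq_conjTranspose] using this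

lemma orth_mul_tr {d : ℕ} {O : Matrix (Fin d) (Fin d) ℝ}
    (h : O ∈ Matrix.orthogonalGroup (Fin d) ℝ) : O * Oᵀ = 1 := by
  have := (Matrix.mem_orthogonalGroup_iff (Fin d) ℝ).1 h
  simpa [Matrix.star_eq_conjTranspose] using this

/-- the deterministic alignment inequality. -/
theorem alignment_inequality
    (n d : ℕ) (X₁ X₂ Xh₁ Xh₂ : Matrix (Fin n) (Fin d) ℝ)
    (W Wh W₁ W₂ : Matrix (Fin d) (Fin d) ℝ)
    (hW : IsProcMin X₁ X₂ W) (hWh : IsProcMin Xh₁ Xh₂ Wh)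
    (hW₁ : IsProcMin Xh₁ X₁ W₁) (hW₂ : IsProcMin Xh₂ X₂ W₂) :
    |frob (Xh₁ * Wh - Xh₂) - frob (X₁ * W - X₂)| ≤
      frob (Xh₁ * W₁ - X₁) + frob (Xh₂ * W₂ - X₂) +
        frob X₁ * spec (W - W₁ᵀ * Wh * W₂) := by
  obtain ⟨oW, mW⟩ := hW
  obtain ⟨oWh, mWh⟩ := hWh
  obtain ⟨o1, -⟩ := hW₁
  obtain ⟨o2, -⟩ := hW₂
  have e1 : W₁ * W₁ᵀ = 1 := orth_mul_tr o1
  have e2' : W₂ᵀ * W₂ = 1 := by simpa using orth_mul_tr (orth_transpose o2)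
  have hs : 0 ≤ frob X₁ * spec (W - W₁ᵀ * Wh * W₂) :=
    mul_nonneg (Real.sqrt_nonneg _) (spec_nonneg _)
  have h1 := mWh (W₁ * W * W₂ᵀ) (mul_mem (mul_mem o1 oW) (orth_transpose o2))
  have oQ := mul_mem (mul_mem (orth_transpose o1) oWh) o2
  have h2 := mW (W₁ᵀ * Wh * W₂) oQ
  rw [← frob_mul_orth (Xh₁ * (W₁ * W * W₂ᵀ) - Xh₂) W₂ (orth_mul_tr o2)] at h1
  have i1 : (Xh₁ * (W₁ * W * W₂ᵀ) - Xh₂) * W₂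
      = (Xh₁ * W₁ - X₁) * W + (X₁ * W - X₂) + -(Xh₂ * W₂ - X₂) := by
    simp only [Matrix.sub_mul, Matrix.mul_assoc, e2', Matrix.mul_one]
    abel
  have i2 : X₁ * (W₁ᵀ * Wh * W₂) - X₂
      = -((Xh₁ * W₁ - X₁) * (W₁ᵀ * Wh * W₂)) + (Xh₁ * Wh - Xh₂) * W₂ + (Xh₂ * W₂ - X₂) := by
    have : Xh₁ * W₁ * (W₁ᵀ * Wh * W₂) = Xh₁ * Wh * W₂ := by
      calc _ = Xh₁ * (W₁ * W₁ᵀ) * Wh * W₂ := by simp only [Matrix.mul_assoc]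
        _ = _ := by rw [e1, Matrix.mul_one]
    rw [Matrix.sub_mul, this, Matrix.sub_mul]
    abel
  rw [i1] at h1
  rw [i2] at h2
  have a1 := frob_add_le ((Xh₁ * W₁ - X₁) * W + (X₁ * W - X₂)) (-(Xh₂ * W₂ - X₂))
  have a2 := frob_add_le ((Xh₁ * W₁ - X₁) * W) (X₁ * W - X₂)
  have b1 := frob_add_le (-((Xh₁ * W₁ - X₁) * (W₁ᵀ * Wh * W₂)) + (Xh₁ * Wh - Xh₂) * W₂)
    (Xh₂ * W₂ - X₂)
  have b2 := frob_add_le (-((Xh₁ * W₁ - X₁) * (W₁ᵀ * Wh * W₂))) ((Xh₁ * Wh - Xh₂) * W₂)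
  rw [frob_neg] at a1 b2
  rw [frob_mul_orth _ _ (orth_mul_tr oW)] at a2
  rw [frob_mul_orth _ _ (orth_mul_tr oQ), frob_mul_orth _ _ (orth_mul_tr o2)] at b2
  rw [abs_le]
  constructor <;> linarith
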